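/- Let f ∈ W^{2,∞}(ℝ/ℤ) be a closed curve in ℝⁿ satisfying the bi-Lipschitz condition, and for each m let 0 ≤ θ₁ < … < θ_m < 1 satisfy the equilateral condition. Define P_{1,ij} = ¼·(g_{ij,d}/g_{ij,n})·( ‖Δᵢf/‖Δᵢf‖ − Δⱼf/‖Δⱼf‖‖² + ‖Δᵢ₊₁f/‖Δᵢ₊₁f‖ − Δⱼ₊₁f/‖Δⱼ₊₁f‖‖² ), where g_{ij,d} = ‖Δᵢf‖‖Δⱼf‖ and g_{ij,n} = ‖Δᵢʲf‖‖Δ_{i+1}^{j+1}f‖. Then lim_{m→∞} Σ_{i≠j (mod m)} P_{1,ij} = E₁(f). -/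

import Mathlib

open MeasureTheory Real
open scoped RealInnerProductSpace ENNReal

noncomputable section

/-- The standard distance on `ℝ/ℤ`, expressed through real representatives. -/
def circleDist (a b : ℝ) : ℝ := min (Int.fract (a - b)) (1 - Int.fract (a - b))

/-- The `H^{1/2}`-seminorm `[u]_{H^{1/2}(I×J)}`. -/
def seminormH {n : ℕ} (u : ℝ → EuclideanSpace ℝ (Fin n)) (I J : Set ℝ) : ℝ :=
  Real.sqrt (∫ a in I, ∫ b in J, ‖u a - u b‖ ^ 2 / circleDist a b ^ 2)

/-- `K(u, ε)`: supremum of the `H^{1/2}`-seminorms of `u` over pairs of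
measurable subsets of `ℝ/ℤ` of measure at most `ε`. -/
def Kmod {n : ℕ} (u : ℝ → EuclideanSpace ℝ (Fin n)) (ε : ℝ) : ℝ :=
  sSup { r : ℝ | ∃ I J : Set ℝ, MeasurableSet I ∧ MeasurableSet J ∧
    I ⊆ Set.Ico (0 : ℝ) 1 ∧ J ⊆ Set.Ico (0 : ℝ) 1 ∧
    volume I ≤ ENNReal.ofReal ε ∧ volume J ≤ ENNReal.ofReal ε ∧
    r = seminormH u I J }

/-- Difference operator `Δᵢ` in the first index. -/
def dOpI (u : ℤ → ℤ → ℝ) (i j : ℤ) : ℝ := u (i + 1) j - u i j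

/-- Difference operator `Δⱼ` in the second index. -/
def dOpJ (u : ℤ → ℤ → ℝ) (i j : ℤ) : ℝ := u i (j + 1) - u i j

/-- Arithmetic mean `Aᵢ` in the first index. -/
def aOpI (u : ℤ → ℤ → ℝ) (i j : ℤ) : ℝ := (u i j + u (i + 1) j) / 2

/-- Arithmetic mean `Aⱼ` in the second index. -/
def aOpJ (u : ℤ → ℤ → ℝ) (i j : ℤ) : ℝ := (u i j + u i (j + 1)) / 2

/-- Arithmetic mean `A_{ij}` over the four corners. -/
def aOpIJ (u : ℤ → ℤ → ℝ) (i j : ℤ) : ℝ :=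
  (u i j + u (i + 1) j + u i (j + 1) + u (i + 1) (j + 1)) / 4

/-- The chord `Δᵢʲf = f(θⱼ) − f(θᵢ)`. -/
def chord {n : ℕ} (f : ℝ → EuclideanSpace ℝ (Fin n)) (θ : ℤ → ℝ) (i j : ℤ) :
    EuclideanSpace ℝ (Fin n) := f (θ j) - f (θ i)

/-- The edge `Δᵢf = f(θᵢ₊₁) − f(θᵢ)`. -/
def edge {n : ℕ} (f : ℝ → EuclideanSpace ℝ (Fin n)) (θ : ℤ → ℝ) (i : ℤ) :
    EuclideanSpace ℝ (Fin n) := f (θ (i + 1)) - f (θ i)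

/-- The unit edge vector `Δᵢf/‖Δᵢf‖`. -/
def uedge {n : ℕ} (f : ℝ → EuclideanSpace ℝ (Fin n)) (θ : ℤ → ℝ) (i : ℤ) :
    EuclideanSpace ℝ (Fin n) := ‖edge f θ i‖⁻¹ • edge f θ i

/-- Chord length `‖Δᵢʲf‖` as a doubly indexed quantity. -/
def chn {n : ℕ} (f : ℝ → EuclideanSpace ℝ (Fin n)) (θ : ℤ → ℝ) (i j : ℤ) : ℝ :=
  ‖chord f θ i j‖


/-- Sum of `F i j` over ordered pairs of distinct residues mod `m`,
represented by indices in `{1, …, m}`. -/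
def discSum (m : ℕ) (F : ℤ → ℤ → ℝ) : ℝ :=
  ∑ i ∈ Finset.Icc (1 : ℤ) (m : ℤ), ∑ j ∈ Finset.Icc (1 : ℤ) (m : ℤ),
    if i = j then 0 else F i j

/-- The discrete cross ratio
`g_{ij} = ‖Δᵢʲf‖‖Δ_{i+1}^{j+1}f‖/(‖Δᵢf‖‖Δⱼf‖)`. -/
def crossRatio {n : ℕ} (f : ℝ → EuclideanSpace ℝ (Fin n)) (θ : ℤ → ℝ)
    (i j : ℤ) : ℝ :=
  (chn f θ i j * chn f θ (i + 1) (j + 1)) / (‖edge f θ i‖ * ‖edge f θ j‖)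

/-- The unit tangent vector `t = f'/‖f'‖`. -/
def tang {n : ℕ} (f : ℝ → EuclideanSpace ℝ (Fin n)) (x : ℝ) :
    EuclideanSpace ℝ (Fin n) := ‖deriv f x‖⁻¹ • deriv f x

lemma circleDist_eq_abs_sub_round (a b : ℝ) :
    circleDist a b = |a - b - round (a - b)| := (abs_sub_round_eq_min (a - b)).symm

lemma circleDist_le_abs_sub (a b : ℝ) : circleDist a b ≤ |a - b| := by
  rw [circleDist_eq_abs_sub_round]
  simpa using round_le (a - b) 0

lemma circleDist_eq_sub {a b : ℝ} (h₀ : a ≤ b) (h₁ : b - a ≤ 1 / 2) :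
    circleDist b a = b - a := by
  have : Int.fract (b - a) = b - a := Int.fract_eq_self.2 ⟨by linarith, by linarith⟩
  rw [circleDist, this, min_eq_left (by linarith)]

lemma circleDist_eq_one_sub {a b : ℝ} (h₀ : 1 / 2 ≤ b - a) (h₁ : b - a < 1) :
    circleDist b a = 1 - (b - a) := by
  have : Int.fract (b - a) = b - a := Int.fract_eq_self.2 ⟨by linarith, by linarith⟩
  rw [circleDist, this, min_eq_right (by linarith)]

/-- The index `i` of the cell `[θᵢ, θᵢ₊₁)` containing `a`. -/
def cellIndex (θ : ℤ → ℝ) (a : ℝ) : ℤ :=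
  Classical.epsilon fun i => θ i ≤ a ∧ a < θ (i + 1)

section Partition

variable {θ : ℤ → ℝ} {m : ℕ}

lemma apply_add_mul_period (hper : ∀ i : ℤ, θ (i + m) = θ i + 1) (i k : ℤ) :
    θ (i + k * m) = θ i + k := by
  induction k using Int.induction_on with
  | zero => simp
  | succ k ih =>
    have := hper (i + k * m)
    rw [ih, add_assoc, ← add_one_mul] at this
    rw [this]; push_cast; ring
  | pred k ih =>
    have := hper (i + (-k - 1) * m)
    rw [add_assoc, ← add_one_mul, sub_add_cancel, ih] at this
    push_cast at this ⊢; linarith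

lemma cell_unique (hmono : StrictMono θ) {a : ℝ} {i j : ℤ} (hi : θ i ≤ a) (hi' : a < θ (i + 1))
    (hj : θ j ≤ a) (hj' : a < θ (j + 1)) : i = j := by
  have h₁ := hmono.lt_iff_lt.1 (hi.trans_lt hj')
  have h₂ := hmono.lt_iff_lt.1 (hj.trans_lt hi')
  lia

lemma cellIndex_spec (hmono : StrictMono θ) (hper : ∀ i : ℤ, θ (i + m) = θ i + 1) (a : ℝ) :
    θ (cellIndex θ a) ≤ a ∧ a < θ (cellIndex θ a + 1) := by
  refine Classical.epsilon_spec (p := fun i => θ i ≤ a ∧ a < θ (i + 1)) ?_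
  have hbdd : ∃ b : ℤ, ∀ z : ℤ, θ z ≤ a → z ≤ b := by
    refine ⟨0 + ⌈a - θ 0⌉ * m, fun z hz => hmono.le_iff_le.1 (hz.trans ?_)⟩
    rw [apply_add_mul_period hper]
    linarith [Int.le_ceil (a - θ 0)]
  have hne : ∃ z : ℤ, θ z ≤ a := by
    refine ⟨0 + ⌊a - θ 0⌋ * m, ?_⟩
    rw [apply_add_mul_period hper]
    linarith [Int.floor_le (a - θ 0)]
  obtain ⟨i, hi, hmax⟩ := Int.exists_greatest_of_bdd hbdd hne
  refine ⟨i, hi, ?_⟩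
  by_contra! h
  have := hmax _ h
  lia

lemma cellIndex_eq (hmono : StrictMono θ) (hper : ∀ i : ℤ, θ (i + m) = θ i + 1) {a : ℝ} {i : ℤ}
    (hi : θ i ≤ a) (hi' : a < θ (i + 1)) : cellIndex θ a = i :=
  cell_unique hmono (cellIndex_spec hmono hper a).1 (cellIndex_spec hmono hper a).2 hi hi'

lemma cellIndex_add_one (hmono : StrictMono θ) (hper : ∀ i : ℤ, θ (i + m) = θ i + 1) (a : ℝ) :
    cellIndex θ (a + 1) = cellIndex θ a + m := by
  obtain ⟨h₁, h₂⟩ := cellIndex_spec hmono hper a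
  refine cellIndex_eq hmono hper ?_ ?_
  · rw [hper]; linarith
  · rw [add_right_comm, hper]; linarith

lemma measurable_cellIndex (hmono : StrictMono θ) (hper : ∀ i : ℤ, θ (i + m) = θ i + 1) :
    Measurable (cellIndex θ) := by
  refine Monotone.measurable fun a b hab => ?_
  have := hmono.lt_iff_lt.1
    (((cellIndex_spec hmono hper a).1.trans hab).trans_lt (cellIndex_spec hmono hper b).2)
  lia

/-- The integral over one period of the step function with mass `g i` on the `i`-th cell. -/
lemma integral_comp_cellIndex (hmono : StrictMono θ) (hper : ∀ i : ℤ, θ (i + m) = θ i + 1)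
    {g : ℤ → ℝ} (hg : ∀ i, g (i + m) = g i) :
    ∫ a in (0 : ℝ)..1, g (cellIndex θ a) /
        (θ (cellIndex θ a + 1) - θ (cellIndex θ a)) =
      ∑ i ∈ Finset.Icc (1 : ℤ) m, g i := by
  set F : ℝ → ℝ := fun a => g (cellIndex θ a) / (θ (cellIndex θ a + 1) - θ (cellIndex θ a))
    with hF
  have hFper : Function.Periodic F 1 := fun a => by
    simp only [hF, cellIndex_add_one hmono hper, hg, add_right_comm _ (m : ℤ) 1, hper]
    congr 1; ring
  have hcell (i : ℤ) : ∀ a ∈ Set.Ico (θ i) (θ (i + 1)), F a = g i / (θ (i + 1) - θ i) :=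
    fun a ha => by simp only [hF, cellIndex_eq hmono hper ha.1 ha.2]
  have hle (i : ℤ) : θ i ≤ θ (i + 1) := (hmono (lt_add_one i)).le
  have hae (i : ℤ) : ∀ᵐ a, a ∈ Set.uIoc (θ i) (θ (i + 1)) →
      F a = g i / (θ (i + 1) - θ i) := by
    have : ∀ᵐ a : ℝ, a ≠ θ (i + 1) := by simp [ae_iff]
    filter_upwards [this] with a ha ha'
    rw [Set.uIoc_of_le (hle i)] at ha'
    exact hcell i a ⟨ha'.1.le, lt_of_le_of_ne ha'.2 ha⟩
  have hint (i : ℤ) : IntervalIntegrable F volume (θ i) (θ (i + 1)) := by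
    refine (intervalIntegrable_const (c := g i / (θ (i + 1) - θ i))).congr_ae ?_
    rw [Filter.EventuallyEq, ae_restrict_iff' measurableSet_uIoc]
    filter_upwards [hae i] with a ha h using (ha h).symm
  have hval (i : ℤ) : ∫ a in θ i..θ (i + 1), F a = g i := by
    have hpos : θ (i + 1) - θ i ≠ 0 := (sub_pos.2 (hmono (lt_add_one i))).ne'
    rw [intervalIntegral.integral_congr_ae (hae i), intervalIntegral.integral_const, smul_eq_mul]
    field_simp
  have hshift := hFper.intervalIntegral_add_eq 0 (θ 1)
  rw [zero_add] at hshift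
  have hadj := intervalIntegral.sum_integral_adjacent_intervals (f := F) (μ := volume)
    (a := fun k : ℕ => θ (1 + k)) (n := m)
    (fun k _ => by simpa [add_assoc] using hint (1 + k))
  have hsum : ∑ i ∈ Finset.Icc (1 : ℤ) m, g i = ∑ k ∈ Finset.range m, g (1 + k) := by
    symm
    refine Finset.sum_bij (fun k _ => 1 + (k : ℤ)) ?_ ?_ ?_ ?_
    · intro k hk; simp at hk ⊢; lia
    · intro k _ l _ h; lia
    · intro i hi
      simp at hi
      exact ⟨(i - 1).toNat, by simp; lia, by lia⟩
    · intros; rfl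
  rw [hsum, hshift, ← hper 1]
  simp only [Nat.cast_zero, add_zero] at hadj
  rw [← hadj]
  refine Finset.sum_congr rfl fun k _ => ?_
  simpa [add_assoc] using hval (1 + k)

end Partition

section Curve

variable {n : ℕ} {f : ℝ → EuclideanSpace ℝ (Fin n)}

lemma apply_add_int (hf_per : ∀ x : ℝ, f (x + 1) = f x) (x : ℝ) (k : ℤ) : f (x + k) = f x := by
  simpa using (show Function.Periodic f 1 from hf_per).int_mul k x

lemma deriv_add_one (hf_per : ∀ x : ℝ, f (x + 1) = f x) (x : ℝ) :
    deriv f (x + 1) = deriv f x := by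
  rw [← deriv_comp_add_const, funext hf_per]

lemma norm_deriv_sub_le_circleDist (hf_per : ∀ x : ℝ, f (x + 1) = f x) {K : NNReal}
    (hlip : LipschitzWith K (deriv f)) (a b : ℝ) :
    ‖deriv f a - deriv f b‖ ≤ K * circleDist a b := by
  rw [circleDist_eq_abs_sub_round, ← apply_add_int (deriv_add_one hf_per) b (round (a - b))]
  have := hlip.dist_le_mul a (b + round (a - b))
  rwa [dist_eq_norm, Real.dist_eq, ← sub_sub] at this

/-- First-order Taylor estimate for a curve with Lipschitz derivative. -/
lemma norm_sub_sub_smul_deriv_le (hC1 : ContDiff ℝ 1 f) {K : NNReal}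
    (hlip : LipschitzWith K (deriv f)) {x y : ℝ} (hxy : x ≤ y) :
    ‖f y - f x - (y - x) • deriv f x‖ ≤ K * (y - x) ^ 2 := by
  have hd : ∀ z, HasDerivAt (fun z => f z - z • deriv f x) (deriv f z - deriv f x) z := fun z => by
    simpa using ((hC1.differentiable one_ne_zero z).hasDerivAt).fun_sub
      ((hasDerivAt_id z).smul_const (deriv f x))
  have := (convex_Icc x y).norm_image_sub_le_of_norm_hasDerivWithin_le (C := K * (y - x))
    (fun z _ => (hd z).hasDerivWithinAt) (fun z hz => ?_)
    (Set.left_mem_Icc.2 hxy) (Set.right_mem_Icc.2 hxy)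
  · rw [Real.norm_of_nonneg (sub_nonneg.2 hxy)] at this
    calc _ = ‖f y - y • deriv f x - (f x - x • deriv f x)‖ := by congr 1; module
      _ ≤ _ := this
      _ = _ := by ring
  · have := hlip.dist_le_mul z x
    rw [dist_eq_norm, Real.dist_eq, abs_of_nonneg (by linarith [hz.1])] at this
    refine this.trans ?_
    gcongr
    exact hz.2

/-- The difference quotient of `f` over the `i`-th cell. -/
def diffQuot (f : ℝ → EuclideanSpace ℝ (Fin n)) (θ : ℤ → ℝ) (i : ℤ) :
    EuclideanSpace ℝ (Fin n) := (θ (i + 1) - θ i)⁻¹ • edge f θ i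

lemma norm_diffQuot {θ : ℤ → ℝ} (hmono : StrictMono θ) (i : ℤ) :
    ‖diffQuot f θ i‖ = ‖edge f θ i‖ / (θ (i + 1) - θ i) := by
  rw [diffQuot, norm_smul, Real.norm_of_nonneg (inv_nonneg.2 (sub_pos.2 (hmono (lt_add_one i))).le)]
  ring

lemma uedge_eq_diffQuot {θ : ℤ → ℝ} (hmono : StrictMono θ) (i : ℤ) :
    uedge f θ i = ‖diffQuot f θ i‖⁻¹ • diffQuot f θ i := by
  have hpos : θ (i + 1) - θ i ≠ 0 := (sub_pos.2 (hmono (lt_add_one i))).ne'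
  rw [norm_diffQuot hmono, diffQuot, uedge, smul_smul]
  congr 1
  field_simp

lemma norm_diffQuot_sub_deriv_le (hC1 : ContDiff ℝ 1 f) {K : NNReal}
    (hlip : LipschitzWith K (deriv f)) {θ : ℤ → ℝ} (hmono : StrictMono θ) (i : ℤ) :
    ‖diffQuot f θ i - deriv f (θ i)‖ ≤ K * (θ (i + 1) - θ i) := by
  have hpos : 0 < θ (i + 1) - θ i := sub_pos.2 (hmono (lt_add_one i))
  have h := norm_sub_sub_smul_deriv_le hC1 hlip (hmono (lt_add_one i)).le
  have : diffQuot f θ i - deriv f (θ i) = (θ (i + 1) - θ i)⁻¹ •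
      (f (θ (i + 1)) - f (θ i) - (θ (i + 1) - θ i) • deriv f (θ i)) := by
    rw [diffQuot, edge, smul_sub _ (f (θ (i + 1)) - f (θ i)), inv_smul_smul₀ hpos.ne']
  rw [this, norm_smul, Real.norm_of_nonneg (inv_nonneg.2 hpos.le)]
  calc _ ≤ (θ (i + 1) - θ i)⁻¹ * (K * (θ (i + 1) - θ i) ^ 2) := by gcongr
    _ = _ := by field_simp

lemma norm_normalize_sub_le {E : Type*} [NormedAddCommGroup E] [NormedSpace ℝ E] {L : ℝ}
    (hL : 0 < L) {x y : E} (hx : L ≤ ‖x‖) (hy : L ≤ ‖y‖) :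
    ‖‖x‖⁻¹ • x - ‖y‖⁻¹ • y‖ ≤ 2 / L * ‖x - y‖ := by
  have hx₀ : 0 < ‖x‖ := hL.trans_le hx
  have hy₀ : 0 < ‖y‖ := hL.trans_le hy
  have h : ‖x‖⁻¹ • x - ‖y‖⁻¹ • y = ‖x‖⁻¹ • (x - y) + (‖x‖⁻¹ * (‖y‖ - ‖x‖) * ‖y‖⁻¹) • y := by
    have : ‖x‖⁻¹ * (‖y‖ - ‖x‖) * ‖y‖⁻¹ = ‖x‖⁻¹ - ‖y‖⁻¹ := by field_simp
    rw [this]; module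
  have h₁ : ‖‖x‖⁻¹ • (x - y)‖ = ‖x‖⁻¹ * ‖x - y‖ := by
    rw [norm_smul, norm_inv, norm_norm]
  have h₂ : ‖(‖x‖⁻¹ * (‖y‖ - ‖x‖) * ‖y‖⁻¹) • y‖ ≤ ‖x‖⁻¹ * ‖x - y‖ := by
    rw [norm_smul, norm_mul, norm_mul, norm_inv, norm_inv, norm_norm, norm_norm,
      inv_mul_cancel_right₀ hy₀.ne']
    gcongr
    rw [norm_sub_rev x y]
    exact abs_norm_sub_norm_le y x
  calc _ ≤ ‖x‖⁻¹ * ‖x - y‖ + ‖x‖⁻¹ * ‖x - y‖ := by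
        rw [h]; exact (norm_add_le _ _).trans (by gcongr; exact h₁.le)
    _ = 2 * ‖x‖⁻¹ * ‖x - y‖ := by ring
    _ ≤ 2 * L⁻¹ * ‖x - y‖ := by gcongr
    _ = _ := by ring

/-- The discrete energy density `P_{1,ij}`. -/
def discreteP1 (f : ℝ → EuclideanSpace ℝ (Fin n)) (θ : ℤ → ℝ) (i j : ℤ) : ℝ :=
  (1 / 4) * ((‖edge f θ i‖ * ‖edge f θ j‖) / (chn f θ i j * chn f θ (i + 1) (j + 1))) *
    (‖uedge f θ i - uedge f θ j‖ ^ 2 + ‖uedge f θ (i + 1) - uedge f θ (j + 1)‖ ^ 2)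

lemma discSum_discreteP1 (f : ℝ → EuclideanSpace ℝ (Fin n)) (θ : ℤ → ℝ) (m : ℕ) :
    discSum m (discreteP1 f θ) =
      ∑ i ∈ Finset.Icc (1 : ℤ) m, ∑ j ∈ Finset.Icc (1 : ℤ) m, discreteP1 f θ i j := by
  refine Finset.sum_congr rfl fun i _ => Finset.sum_congr rfl fun j _ => ?_
  split_ifs with h
  · simp [h, discreteP1]
  · rfl

section Periodic

variable {θ : ℤ → ℝ} {m : ℕ}

lemma edge_add_period (hf_per : ∀ x : ℝ, f (x + 1) = f x)
    (hper : ∀ i : ℤ, θ (i + m) = θ i + 1) (i : ℤ) : edge f θ (i + m) = edge f θ i := by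
  simp only [edge, add_right_comm _ (m : ℤ) 1, hper, hf_per]

lemma uedge_add_period (hf_per : ∀ x : ℝ, f (x + 1) = f x)
    (hper : ∀ i : ℤ, θ (i + m) = θ i + 1) (i : ℤ) : uedge f θ (i + m) = uedge f θ i := by
  simp only [uedge, edge_add_period hf_per hper]

lemma discreteP1_add_period_left (hf_per : ∀ x : ℝ, f (x + 1) = f x)
    (hper : ∀ i : ℤ, θ (i + m) = θ i + 1) (i j : ℤ) :
    discreteP1 f θ (i + m) j = discreteP1 f θ i j := by
  simp only [discreteP1, chn, chord, add_right_comm _ (m : ℤ) 1, hper, hf_per,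
    edge_add_period hf_per hper, uedge_add_period hf_per hper]

lemma discreteP1_add_period_right (hf_per : ∀ x : ℝ, f (x + 1) = f x)
    (hper : ∀ i : ℤ, θ (i + m) = θ i + 1) (i j : ℤ) :
    discreteP1 f θ i (j + m) = discreteP1 f θ i j := by
  simp only [discreteP1, chn, chord, add_right_comm _ (m : ℤ) 1, hper, hf_per,
    edge_add_period hf_per hper, uedge_add_period hf_per hper]

end Periodic

/-- The bi-Lipschitz condition on a closed curve, with constants `L₁ ≤ L₂`. -/
structure IsBiLipschitzCurve (f : ℝ → EuclideanSpace ℝ (Fin n)) (L₁ L₂ : ℝ) : Prop where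
  pos : 0 < L₁
  le : L₁ ≤ L₂
  lower (a b : ℝ) : L₁ * circleDist a b ≤ ‖f a - f b‖
  upper (a b : ℝ) : ‖f a - f b‖ ≤ L₂ * circleDist a b

/-- A partition of `ℝ/ℤ` into `m` cells whose edges along `f` all have length `e`, with `m` large
compared to the bi-Lipschitz constants. -/
structure IsEquilateral (f : ℝ → EuclideanSpace ℝ (Fin n)) (L₁ L₂ : ℝ) (θ : ℤ → ℝ) (m : ℕ)
    (e : ℝ) : Prop where
  mono : StrictMono θ
  per (i : ℤ) : θ (i + m) = θ i + 1
  norm_edge (i : ℤ) : ‖edge f θ i‖ = e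
  large : L₂ < L₁ * (m - 1)

namespace IsEquilateral

variable {L₁ L₂ : ℝ} {θ : ℤ → ℝ} {m : ℕ} {e : ℝ}

lemma two_le (h : IsEquilateral f L₁ L₂ θ m e) (hf : IsBiLipschitzCurve f L₁ L₂) : 2 ≤ m := by
  have h₁ := h.large
  have h₂ := hf.pos
  have h₃ := hf.le
  have : (1 : ℝ) < m := by nlinarith
  exact_mod_cast this

lemma sub_pos (h : IsEquilateral f L₁ L₂ θ m e) (i : ℤ) : 0 < θ (i + 1) - θ i :=
  _root_.sub_pos.2 (h.mono (lt_add_one i))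

lemma le_mul_sub (h : IsEquilateral f L₁ L₂ θ m e) (hf : IsBiLipschitzCurve f L₁ L₂) (i : ℤ) :
    e ≤ L₂ * (θ (i + 1) - θ i) := by
  rw [← h.norm_edge i]
  refine (hf.upper _ _).trans ?_
  have := circleDist_le_abs_sub (θ (i + 1)) (θ i)
  rw [abs_of_pos (h.sub_pos i)] at this
  have := hf.pos.trans_le hf.le
  gcongr

lemma nat_mul_le (h : IsEquilateral f L₁ L₂ θ m e) (hf : IsBiLipschitzCurve f L₁ L₂) (i : ℤ)
    (k : ℕ) : k * e ≤ L₂ * (θ (i + k) - θ i) := by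
  induction k with
  | zero => simp
  | succ k ih =>
    have := h.le_mul_sub hf (i + k)
    push_cast
    rw [← add_assoc]
    linarith

lemma period_mul_le (h : IsEquilateral f L₁ L₂ θ m e) (hf : IsBiLipschitzCurve f L₁ L₂) :
    m * e ≤ L₂ := by
  simpa only [h.per, add_sub_cancel_left, mul_one] using h.nat_mul_le hf 0 m

lemma sub_le_half (h : IsEquilateral f L₁ L₂ θ m e) (hf : IsBiLipschitzCurve f L₁ L₂) (i : ℤ) :
    θ (i + 1) - θ i ≤ 1 / 2 := by
  by_contra! hlt
  have hm := h.two_le hf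
  have hL := hf.pos
  have hlt₁ : θ (i + 1) - θ i < 1 := by
    have := h.mono (show i + 1 < i + m by lia)
    rw [h.per] at this
    linarith
  have he := hf.lower (θ (i + 1)) (θ i)
  rw [circleDist_eq_one_sub hlt.le hlt₁, ← edge, h.norm_edge] at he
  have hk := h.nat_mul_le hf (i + 1) (m - 1)
  have hcast : i + 1 + ((m - 1 : ℕ) : ℤ) = i + m := by lia
  rw [hcast, h.per, Nat.cast_sub (by lia), Nat.cast_one] at hk
  have hpos : 0 < 1 - (θ (i + 1) - θ i) := by linarith
  have hl := h.large
  have hm' : (0 : ℝ) < m - 1 := by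
    have : (2 : ℝ) ≤ m := by exact_mod_cast hm
    linarith
  have : (m - 1) * (L₁ * (1 - (θ (i + 1) - θ i))) ≤ (m - 1 : ℝ) * e := by gcongr
  nlinarith

lemma mul_sub_le (h : IsEquilateral f L₁ L₂ θ m e) (hf : IsBiLipschitzCurve f L₁ L₂) (i : ℤ) :
    L₁ * (θ (i + 1) - θ i) ≤ e := by
  have := hf.lower (θ (i + 1)) (θ i)
  rwa [circleDist_eq_sub (h.mono (lt_add_one i)).le (h.sub_le_half hf i), ← edge, h.norm_edge] at this

lemma edge_pos (h : IsEquilateral f L₁ L₂ θ m e) (hf : IsBiLipschitzCurve f L₁ L₂) : 0 < e :=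
  (mul_pos hf.pos (h.sub_pos 0)).trans_le (h.mul_sub_le hf 0)

lemma mesh_le (h : IsEquilateral f L₁ L₂ θ m e) (hf : IsBiLipschitzCurve f L₁ L₂) (i : ℤ) :
    θ (i + 1) - θ i ≤ L₂ / L₁ / m := by
  have hm : (0 : ℝ) < m := by exact_mod_cast two_pos.trans_le (h.two_le hf)
  rw [div_div, le_div_iff₀ (mul_pos hf.pos hm)]
  have h₁ := h.mul_sub_le hf i
  have h₂ := h.period_mul_le hf
  nlinarith

lemma le_norm_diffQuot (h : IsEquilateral f L₁ L₂ θ m e) (hf : IsBiLipschitzCurve f L₁ L₂)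
    (i : ℤ) : L₁ ≤ ‖diffQuot f θ i‖ := by
  rw [norm_diffQuot h.mono, h.norm_edge, le_div_iff₀ (h.sub_pos i)]
  exact h.mul_sub_le hf i

lemma norm_diffQuot_le (h : IsEquilateral f L₁ L₂ θ m e) (hf : IsBiLipschitzCurve f L₁ L₂)
    (i : ℤ) : ‖diffQuot f θ i‖ ≤ L₂ := by
  rw [norm_diffQuot h.mono, h.norm_edge, div_le_iff₀ (h.sub_pos i)]
  exact h.le_mul_sub hf i

lemma le_mul_circleDist (h : IsEquilateral f L₁ L₂ θ m e) (hf : IsBiLipschitzCurve f L₁ L₂)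
    {i j : ℤ} (hij : ¬ (m : ℤ) ∣ i - j) : e ≤ L₂ * circleDist (θ j) (θ i) := by
  set r := round (θ j - θ i) with hr
  have hL : 0 ≤ L₂ := hf.pos.le.trans hf.le
  have hd : circleDist (θ j) (θ i) = |θ j - θ (i + r * m)| := by
    rw [circleDist_eq_abs_sub_round, apply_add_mul_period h.per, sub_add_eq_sub_sub]
  have hne : i + r * m ≠ j := fun H => hij ⟨-r, by rw [← H]; ring⟩
  rw [hd]
  rcases lt_or_gt_of_ne hne with hlt | hlt
  · refine (h.le_mul_sub hf (i + r * m)).trans ?_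
    have := h.mono.monotone (show i + r * m + 1 ≤ j by lia)
    gcongr
    exact (sub_le_sub_right this _).trans (le_abs_self _)
  · refine (h.le_mul_sub hf j).trans ?_
    have := h.mono.monotone (show j + 1 ≤ i + r * m by lia)
    rw [abs_sub_comm]
    gcongr
    exact (sub_le_sub_right this _).trans (le_abs_self _)

lemma edge_le_mul_chn (h : IsEquilateral f L₁ L₂ θ m e) (hf : IsBiLipschitzCurve f L₁ L₂)
    {i j : ℤ} (hij : ¬ (m : ℤ) ∣ i - j) : e ≤ L₂ / L₁ * chn f θ i j := by
  have h₁ := h.le_mul_circleDist hf hij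
  have h₂ := hf.lower (θ j) (θ i)
  have hL := hf.pos
  have hL' := hL.trans_le hf.le
  rw [div_mul_eq_mul_div, le_div_iff₀ hL, chn, chord]
  nlinarith

lemma abs_chn_succ_sub_le (h : IsEquilateral f L₁ L₂ θ m e) (i j : ℤ) :
    |chn f θ (i + 1) (j + 1) - chn f θ i j| ≤ 2 * e := by
  refine (abs_norm_sub_norm_le _ _).trans ?_
  have : chord f θ (i + 1) (j + 1) - chord f θ i j = edge f θ j - edge f θ i := by
    simp only [chord, edge]; abel
  rw [this]
  refine (norm_sub_le _ _).trans ?_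
  rw [h.norm_edge, h.norm_edge, two_mul]

lemma norm_uedge_sub_le (h : IsEquilateral f L₁ L₂ θ m e) (hf : IsBiLipschitzCurve f L₁ L₂)
    (hf_per : ∀ x : ℝ, f (x + 1) = f x) (hC1 : ContDiff ℝ 1 f) {K : NNReal}
    (hlip : LipschitzWith K (deriv f)) {i j : ℤ} (hij : ¬ (m : ℤ) ∣ i - j) :
    ‖uedge f θ i - uedge f θ j‖ ≤ 2 / L₁ * (K / L₁ * (1 + 2 * (L₂ / L₁))) * chn f θ i j := by
  have hL := hf.pos
  rw [uedge_eq_diffQuot h.mono, uedge_eq_diffQuot h.mono, mul_assoc]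
  refine (norm_normalize_sub_le hL (h.le_norm_diffQuot hf i) (h.le_norm_diffQuot hf j)).trans ?_
  gcongr
  have hstep (k : ℤ) : ‖diffQuot f θ k - deriv f (θ k)‖ ≤ K / L₁ * e := by
    refine (norm_diffQuot_sub_deriv_le hC1 hlip h.mono k).trans ?_
    rw [div_mul_eq_mul_div, mul_div_assoc]
    gcongr
    rw [le_div_iff₀ hL, mul_comm]
    exact h.mul_sub_le hf k
  have hmid : ‖deriv f (θ i) - deriv f (θ j)‖ ≤ K / L₁ * chn f θ i j := by
    rw [norm_sub_rev]
    refine (norm_deriv_sub_le_circleDist hf_per hlip _ _).trans ?_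
    rw [div_mul_eq_mul_div, mul_div_assoc]
    gcongr
    rw [le_div_iff₀ hL, mul_comm]
    exact hf.lower _ _
  have hsplit : diffQuot f θ i - diffQuot f θ j = (diffQuot f θ i - deriv f (θ i)) +
      (deriv f (θ i) - deriv f (θ j)) - (diffQuot f θ j - deriv f (θ j)) := by abel
  have he : K / L₁ * e ≤ K / L₁ * (L₂ / L₁ * chn f θ i j) := by
    gcongr
    exact h.edge_le_mul_chn hf hij
  rw [hsplit]
  refine (norm_sub_le _ _).trans ?_
  have := norm_add_le (diffQuot f θ i - deriv f (θ i)) (deriv f (θ i) - deriv f (θ j))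
  have := hstep i
  have := hstep j
  linarith

lemma discreteP1_div_eq (h : IsEquilateral f L₁ L₂ θ m e) (i j : ℤ) :
    discreteP1 f θ i j / ((θ (i + 1) - θ i) * (θ (j + 1) - θ j)) =
      (1 / 4) * ((‖diffQuot f θ i‖ * ‖diffQuot f θ j‖) /
        (chn f θ i j * chn f θ (i + 1) (j + 1))) *
        (‖uedge f θ i - uedge f θ j‖ ^ 2 + ‖uedge f θ (i + 1) - uedge f θ (j + 1)‖ ^ 2) := by
  rw [norm_diffQuot h.mono, norm_diffQuot h.mono, discreteP1]
  generalize θ (i + 1) - θ i = s, θ (j + 1) - θ j = t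
  ring

/-- The discrete energy density is bounded, uniformly in the partition. -/
lemma abs_discreteP1_div_le (h : IsEquilateral f L₁ L₂ θ m e) (hf : IsBiLipschitzCurve f L₁ L₂)
    (hf_per : ∀ x : ℝ, f (x + 1) = f x) (hC1 : ContDiff ℝ 1 f) {K : NNReal}
    (hlip : LipschitzWith K (deriv f)) (i j : ℤ) :
    |discreteP1 f θ i j / ((θ (i + 1) - θ i) * (θ (j + 1) - θ j))| ≤
      L₂ ^ 2 / 2 * (2 / L₁ * (K / L₁ * (1 + 2 * (L₂ / L₁)))) ^ 2 * (1 + 2 * (L₂ / L₁)) := by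
  have hL := hf.pos
  have hL' := hL.trans_le hf.le
  set R := 1 + 2 * (L₂ / L₁) with hR
  set A := 2 / L₁ * (K / L₁ * R) with hA
  have hR₀ : 0 < R := by positivity
  by_cases hij : (m : ℤ) ∣ i - j
  · obtain ⟨k, hk⟩ := hij
    have hi : i = j + k * m := by linarith
    have : chn f θ i j = 0 := by
      rw [chn, chord, hi, apply_add_mul_period h.per, apply_add_int hf_per, sub_self, norm_zero]
    rw [discreteP1, this]
    simp only [zero_mul, div_zero, mul_zero, zero_div, abs_zero]
    positivity
  have hij' : ¬ (m : ℤ) ∣ (i + 1) - (j + 1) := by rwa [add_sub_add_right_eq_sub]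
  rw [h.discreteP1_div_eq]
  have hD := h.edge_le_mul_chn hf hij
  have hD' := h.edge_le_mul_chn hf hij'
  have hu := h.norm_uedge_sub_le hf hf_per hC1 hlip hij
  have hu' := h.norm_uedge_sub_le hf hf_per hC1 hlip hij'
  obtain ⟨hlo, hup⟩ := abs_le.1 (h.abs_chn_succ_sub_le i j)
  have hc := div_pos hL' hL
  have he := h.edge_pos hf
  set D := chn f θ i j
  set D' := chn f θ (i + 1) (j + 1)
  have hDpos : 0 < D := pos_of_mul_pos_right (he.trans_le hD) hc.le
  have hDpos' : 0 < D' := pos_of_mul_pos_right (he.trans_le hD') hc.le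
  have hDD : D ≤ R * D' := by rw [hR]; linarith
  have hDD' : D' ≤ R * D := by rw [hR]; linarith
  have hsq : ‖uedge f θ i - uedge f θ j‖ ^ 2 ≤ A ^ 2 * R * (D * D') :=
    calc _ ≤ (A * D) ^ 2 := by gcongr
      _ = A ^ 2 * D * D := by ring
      _ ≤ A ^ 2 * D * (R * D') := by gcongr
      _ = _ := by ring
  have hsq' : ‖uedge f θ (i + 1) - uedge f θ (j + 1)‖ ^ 2 ≤ A ^ 2 * R * (D * D') :=
    calc _ ≤ (A * D') ^ 2 := by gcongr
      _ = A ^ 2 * D' * D' := by ring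
      _ ≤ A ^ 2 * D' * (R * D) := by gcongr
      _ = _ := by ring
  rw [abs_of_nonneg (by positivity)]
  have hq := h.norm_diffQuot_le hf i
  have hq' := h.norm_diffQuot_le hf j
  calc _ ≤ (1 / 4) * ((L₂ * L₂) / (D * D')) *
        (A ^ 2 * R * (D * D') + A ^ 2 * R * (D * D')) := by gcongr
    _ = _ := by field_simp; ring

/-- The double sum of the discrete density is the double integral of a step function. -/
lemma integral_integral_discreteP1 (h : IsEquilateral f L₁ L₂ θ m e)
    (hf_per : ∀ x : ℝ, f (x + 1) = f x) :
    ∫ a in (0 : ℝ)..1, ∫ b in (0 : ℝ)..1,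
        discreteP1 f θ (cellIndex θ a) (cellIndex θ b) /
          ((θ (cellIndex θ a + 1) - θ (cellIndex θ a)) *
            (θ (cellIndex θ b + 1) - θ (cellIndex θ b))) =
      discSum m (discreteP1 f θ) := by
  have hinner (i : ℤ) := integral_comp_cellIndex h.mono h.per
    (g := fun j => discreteP1 f θ i j / (θ (i + 1) - θ i))
    (fun j => by simp only [discreteP1_add_period_right hf_per h.per])
  simp only [← div_div, hinner, ← Finset.sum_div]
  rw [discSum_discreteP1]
  exact integral_comp_cellIndex h.mono h.per
    (g := fun i => ∑ j ∈ Finset.Icc (1 : ℤ) m, discreteP1 f θ i j)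
    (fun i => by simp only [discreteP1_add_period_left hf_per h.per])

lemma measurable_comp_cellIndex (h : IsEquilateral f L₁ L₂ θ m e) (g : ℤ → ℝ) :
    Measurable fun a => g (cellIndex θ a) :=
  (measurable_of_countable g).comp (measurable_cellIndex h.mono h.per)

end IsEquilateral

section Limit

variable {L₁ L₂ : ℝ} {θ : ℕ → ℤ → ℝ} {e : ℕ → ℝ}

open Filter Topology

lemma tendsto_diffQuot (hC1 : ContDiff ℝ 1 f) {K : NNReal} (hlip : LipschitzWith K (deriv f))
    (hmono : ∀ᶠ m in atTop, StrictMono (θ m)) {i : ℕ → ℤ} {a : ℝ}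
    (h₀ : Tendsto (fun m => θ m (i m)) atTop (𝓝 a))
    (h₁ : Tendsto (fun m => θ m (i m + 1)) atTop (𝓝 a)) :
    Tendsto (fun m => diffQuot f (θ m) (i m)) atTop (𝓝 (deriv f a)) := by
  have hd : Tendsto (fun m => diffQuot f (θ m) (i m) - deriv f (θ m (i m))) atTop (𝓝 0) := by
    refine squeeze_zero_norm' (a := fun m => K * (θ m (i m + 1) - θ m (i m))) ?_ ?_
    · filter_upwards [hmono] with m hm using norm_diffQuot_sub_deriv_le hC1 hlip hm _
    · simpa using (h₁.sub h₀).const_mul (K : ℝ)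
  simpa using hd.add ((hlip.continuous.tendsto a).comp h₀)

lemma tendsto_uedge (hC1 : ContDiff ℝ 1 f) {K : NNReal} (hlip : LipschitzWith K (deriv f))
    (hmono : ∀ᶠ m in atTop, StrictMono (θ m)) {i : ℕ → ℤ} {a : ℝ} (ha : deriv f a ≠ 0)
    (h₀ : Tendsto (fun m => θ m (i m)) atTop (𝓝 a))
    (h₁ : Tendsto (fun m => θ m (i m + 1)) atTop (𝓝 a)) :
    Tendsto (fun m => uedge f (θ m) (i m)) atTop (𝓝 (tang f a)) := by
  have h := tendsto_diffQuot hC1 hlip hmono h₀ h₁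
  refine ((h.norm.inv₀ (norm_ne_zero_iff.2 ha)).smul h).congr' ?_
  filter_upwards [hmono] with m hm using (uedge_eq_diffQuot hm _).symm

lemma tendsto_apply_add_one (hf : IsBiLipschitzCurve f L₁ L₂)
    (h : ∀ᶠ m in atTop, IsEquilateral f L₁ L₂ (θ m) m (e m)) {i : ℕ → ℤ} {a : ℝ}
    (h₀ : Tendsto (fun m => θ m (i m)) atTop (𝓝 a)) :
    Tendsto (fun m => θ m (i m + 1)) atTop (𝓝 a) := by
  have hd : Tendsto (fun m => θ m (i m + 1) - θ m (i m)) atTop (𝓝 0) := by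
    refine squeeze_zero' ?_ ?_ (tendsto_const_div_atTop_nhds_zero_nat (L₂ / L₁))
    · filter_upwards [h] with m hm using (hm.sub_pos _).le
    · filter_upwards [h] with m hm using hm.mesh_le hf _
  simpa using hd.add h₀

lemma tendsto_apply_cellIndex (hf : IsBiLipschitzCurve f L₁ L₂)
    (h : ∀ᶠ m in atTop, IsEquilateral f L₁ L₂ (θ m) m (e m)) (a : ℝ) :
    Tendsto (fun m => θ m (cellIndex (θ m) a)) atTop (𝓝 a) := by
  have hd : Tendsto (fun m => a - θ m (cellIndex (θ m) a)) atTop (𝓝 0) := by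
    refine squeeze_zero' ?_ ?_ (tendsto_const_div_atTop_nhds_zero_nat (L₂ / L₁))
    · filter_upwards [h] with m hm
      linarith [(cellIndex_spec hm.mono hm.per a).1]
    · filter_upwards [h] with m hm
      linarith [hm.mesh_le hf (cellIndex (θ m) a), (cellIndex_spec hm.mono hm.per a).2]
  simpa using hd.const_sub a

/-- Pointwise convergence of the discrete energy density off the diagonal. -/
lemma tendsto_discreteP1_div (hf : IsBiLipschitzCurve f L₁ L₂) (hC1 : ContDiff ℝ 1 f)
    {K : NNReal} (hlip : LipschitzWith K (deriv f))
    (h : ∀ᶠ m in atTop, IsEquilateral f L₁ L₂ (θ m) m (e m)) {a b : ℝ} (hab : f a ≠ f b) :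
    Tendsto (fun m => discreteP1 f (θ m) (cellIndex (θ m) a) (cellIndex (θ m) b) /
        ((θ m (cellIndex (θ m) a + 1) - θ m (cellIndex (θ m) a)) *
          (θ m (cellIndex (θ m) b + 1) - θ m (cellIndex (θ m) b)))) atTop
      (𝓝 ((1 / 2) *
        (‖tang f a - tang f b‖ ^ 2 * (‖deriv f a‖ * ‖deriv f b‖) / ‖f a - f b‖ ^ 2))) := by
  have hmono : ∀ᶠ m in atTop, StrictMono (θ m) := h.mono fun m hm => hm.mono
  have hθ₀ := tendsto_apply_cellIndex hf h
  have hθ₁ (x : ℝ) := tendsto_apply_add_one hf h (hθ₀ x)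
  have hθ₂ (x : ℝ) := tendsto_apply_add_one hf h (hθ₁ x)
  have hq (x : ℝ) := tendsto_diffQuot hC1 hlip hmono (hθ₀ x) (hθ₁ x)
  have hne (x : ℝ) : deriv f x ≠ 0 := norm_pos_iff.1 <| hf.pos.trans_le <|
    ge_of_tendsto (hq x).norm (h.mono fun m hm => hm.le_norm_diffQuot hf _)
  have hu (x : ℝ) := tendsto_uedge hC1 hlip hmono (hne x) (hθ₀ x) (hθ₁ x)
  have hu' (x : ℝ) := tendsto_uedge hC1 hlip hmono (hne x) (hθ₁ x) (hθ₂ x)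
  have hf₀ (x : ℝ) := (hC1.continuous.tendsto x).comp (hθ₀ x)
  have hf₁ (x : ℝ) := (hC1.continuous.tendsto x).comp (hθ₁ x)
  have hchn := ((hf₀ b).sub (hf₀ a)).norm.mul ((hf₁ b).sub (hf₁ a)).norm
  have hfab : ‖f b - f a‖ ≠ 0 := norm_ne_zero_iff.2 (sub_ne_zero.2 hab.symm)
  have hlim := ((((hq a).norm.mul (hq b).norm).div hchn (mul_ne_zero hfab hfab)).const_mul
    (1 / 4 : ℝ)).mul ((((hu a).sub (hu b)).norm.pow 2).add (((hu' a).sub (hu' b)).norm.pow 2))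
  convert hlim.congr' ?_ using 2
  · rw [norm_sub_rev (f a)]; ring
  · filter_upwards [h] with m hm
    rw [hm.discreteP1_div_eq]
    rfl

lemma ae_ne_of_isBiLipschitzCurve (hf : IsBiLipschitzCurve f L₁ L₂) (a : ℝ) :
    ∀ᵐ b : ℝ, f a ≠ f b := by
  have hcount : (Set.range fun k : ℤ => a - k).Countable := Set.countable_range _
  filter_upwards [hcount.ae_notMem volume] with b hb hab
  have h₀ := hf.lower a b
  rw [hab, sub_self, norm_zero, circleDist_eq_abs_sub_round] at h₀
  have h₁ : |a - b - round (a - b)| ≤ 0 := nonpos_of_mul_nonpos_right h₀ hf.pos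
  exact hb ⟨round (a - b), by linarith [abs_nonpos_iff.1 h₁]⟩

lemma tendsto_discSum_discreteP1 (hf : IsBiLipschitzCurve f L₁ L₂)
    (hf_per : ∀ x : ℝ, f (x + 1) = f x) (hC1 : ContDiff ℝ 1 f)
    {K : NNReal} (hlip : LipschitzWith K (deriv f))
    (h : ∀ᶠ m in atTop, IsEquilateral f L₁ L₂ (θ m) m (e m)) :
    Tendsto (fun m => discSum m (discreteP1 f (θ m))) atTop
      (𝓝 ((1 / 2) * ∫ a in (0 : ℝ)..1, ∫ b in (0 : ℝ)..1,
        ‖tang f a - tang f b‖ ^ 2 * (‖deriv f a‖ * ‖deriv f b‖) / ‖f a - f b‖ ^ 2)) := by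
  rw [← intervalIntegral.integral_const_mul]
  simp_rw [← intervalIntegral.integral_const_mul]
  set C := L₂ ^ 2 / 2 * (2 / L₁ * (K / L₁ * (1 + 2 * (L₂ / L₁)))) ^ 2 * (1 + 2 * (L₂ / L₁))
  refine Tendsto.congr' (h.mono fun m hm => hm.integral_integral_discreteP1 hf_per) ?_
  refine intervalIntegral.tendsto_integral_filter_of_dominated_convergence (fun _ => C)
    ?_ ?_ intervalIntegrable_const (ae_of_all _ fun a _ => ?_)
  · filter_upwards [h] with m hm
    exact (hm.measurable_comp_cellIndex fun i => ∫ b in (0 : ℝ)..1,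
      discreteP1 f (θ m) i (cellIndex (θ m) b) / ((θ m (i + 1) - θ m i) *
        (θ m (cellIndex (θ m) b + 1) - θ m (cellIndex (θ m) b)))).aestronglyMeasurable
  · filter_upwards [h] with m hm
    refine ae_of_all _ fun a _ => ?_
    refine (intervalIntegral.norm_integral_le_of_norm_le_const fun b _ =>
      hm.abs_discreteP1_div_le hf hf_per hC1 hlip _ _).trans ?_
    simp [C]
  · refine intervalIntegral.tendsto_integral_filter_of_dominated_convergence (fun _ => C)
      ?_ ?_ intervalIntegrable_const ?_
    · filter_upwards [h] with m hm
      exact (hm.measurable_comp_cellIndex fun j =>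
        discreteP1 f (θ m) (cellIndex (θ m) a) j /
          ((θ m (cellIndex (θ m) a + 1) - θ m (cellIndex (θ m) a)) *
            (θ m (j + 1) - θ m j))).aestronglyMeasurable
    · filter_upwards [h] with m hm
      exact ae_of_all _ fun b _ => hm.abs_discreteP1_div_le hf hf_per hC1 hlip _ _
    · filter_upwards [ae_ne_of_isBiLipschitzCurve hf a] with b hb _
      exact tendsto_discreteP1_div hf hC1 hlip h hb

end Limit

end Curve

/-- Convergence of the principal part `P_{1,ij}` of the discrete energy density
to the first decomposed Möbius energy `E₁(f)`. -/
theorem discreteP1_tendsto_E1 (n : ℕ)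
    (f : ℝ → EuclideanSpace ℝ (Fin n))
    (hf_per : ∀ x : ℝ, f (x + 1) = f x)
    (hC1 : ContDiff ℝ 1 f)
    (Kf : NNReal) (hlip : LipschitzWith Kf (deriv f))
    (L₁ L₂ : ℝ) (hL₁ : 0 < L₁) (hL₁₂ : L₁ ≤ L₂)
    (hbl : ∀ a b : ℝ,
      L₁ * circleDist a b ≤ ‖f a - f b‖ ∧ ‖f a - f b‖ ≤ L₂ * circleDist a b)
    (θ : ℕ → ℤ → ℝ)
    (hmono : ∀ m : ℕ, 1 ≤ m → StrictMono (θ m))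
    (hθper : ∀ m : ℕ, 1 ≤ m → ∀ i : ℤ, θ m (i + m) = θ m i + 1)
    (hθ0 : ∀ m : ℕ, 1 ≤ m → 0 ≤ θ m 1)
    (hθ1 : ∀ m : ℕ, 1 ≤ m → θ m (m : ℤ) < 1)
    (Lm : ℕ → ℝ)
    (hLm : ∀ m : ℕ, Lm m = ∑ i ∈ Finset.Icc (1 : ℤ) (m : ℤ), ‖edge f (θ m) i‖)
    (heq : ∀ m : ℕ, 1 ≤ m → ∀ i : ℤ, ‖edge f (θ m) i‖ = Lm m / m)
 :
    Filter.Tendsto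
      (fun m : ℕ => discSum m (fun i j =>
        (1 / 4) *
          ((‖edge f (θ m) i‖ * ‖edge f (θ m) j‖) /
            (chn f (θ m) i j * chn f (θ m) (i + 1) (j + 1))) *
          (‖uedge f (θ m) i - uedge f (θ m) j‖ ^ 2 +
            ‖uedge f (θ m) (i + 1) - uedge f (θ m) (j + 1)‖ ^ 2)))
      Filter.atTop
      (nhds ((1 / 2) * ∫ a in (0:ℝ)..1, ∫ b in (0:ℝ)..1,
        ‖tang f a - tang f b‖ ^ 2 * (‖deriv f a‖ * ‖deriv f b‖) / ‖f a - f b‖ ^ 2)) := by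
  have hf : IsBiLipschitzCurve f L₁ L₂ :=
    ⟨hL₁, hL₁₂, fun a b => (hbl a b).1, fun a b => (hbl a b).2⟩
  refine tendsto_discSum_discreteP1 (e := fun m => Lm m / m) hf hf_per hC1 hlip ?_
  have hlarge : ∀ᶠ m : ℕ in Filter.atTop, L₂ / L₁ + 1 < m :=
    tendsto_natCast_atTop_atTop.eventually_gt_atTop _
  filter_upwards [Filter.eventually_ge_atTop 1, hlarge] with m hm hm'
  refine ⟨hmono m hm, hθper m hm, heq m hm, ?_⟩
  rw [mul_comm, ← div_lt_iff₀ hL₁]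
  linarith

end
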